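/- MLR is not positively Medvedev reducible to Either(MLR): there is no positive reduction Φ such that Φ^X ∈ MLR for every X ∈ Either(MLR). In symbols, MLR ≰_{s,p} Either(MLR). -/

import Mathlib

open MeasureTheory

/-- Cantor space `2^ω`: functions from `ℕ` to `Bool`. -/
abbrev Cantor : Type := ℕ → Bool

/-- The fair-coin product measure on Cantor space (each bit is `true` with probability 1/2,
independently), realized concretely as the pushforward of Lebesgue measure on `[0,1)`
under the binary-digit map `x ↦ (n ↦ n-th binary digit of x)`. -/
noncomputable def fairCoin : Measure Cantor :=
  Measure.map (fun (x : ℝ) (n : ℕ) => decide ((⌊x * 2 ^ (n + 1)⌋ % 2 : ℤ) = 1))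
    (volume.restrict (Set.Ico (0 : ℝ) 1))

/-- The cylinder `[σ]` of all `X ∈ 2^ω` extending the finite binary string `σ`. -/
def cylinder (σ : List Bool) : Set Cantor :=
  {X | ∀ (i : ℕ) (h : i < σ.length), X i = σ.get ⟨i, h⟩}

/-- The `n`-th level `U_n` of a test `U`: the union of the cylinders enumerated by `U n`. -/
def testSet (U : ℕ → ℕ → Option (List Bool)) (n : ℕ) : Set Cantor :=
  ⋃ σ ∈ {σ : List Bool | ∃ k, U n k = some σ}, cylinder σ

/-- A Martin-Löf test: a computable enumeration of cylinders with `μ(U_n) ≤ 2^{-n}`. -/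
def MLTest (U : ℕ → ℕ → Option (List Bool)) : Prop :=
  Computable₂ U ∧ ∀ n, fairCoin (testSet U n) ≤ ((2 : ENNReal) ^ n)⁻¹

/-- The Martin-Löf random elements of Cantor space. -/
def MLR : Set Cantor :=
  {X | ∀ U : ℕ → ℕ → Option (List Bool), MLTest U → ∃ n, X ∉ testSet U n}

/-- The computability-theoretic join: `(A ⊕ B)(2k) = A(k)` and `(A ⊕ B)(2k+1) = B(k)`. -/
def join (A B : Cantor) : Cantor := fun n => if n % 2 = 0 then A (n / 2) else B (n / 2)

/-- `Either(C) = {A ⊕ B : A ∈ C or B ∈ C}`. -/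
def Either (C : Set Cantor) : Set Cantor :=
  {Z | ∃ A B : Cantor, Z = join A B ∧ (A ∈ C ∨ B ∈ C)}

/-- The output `Φ^X` of the positive reduction given by the positive CNFs `c n`:
`Φ^X(n) = ⋀_{clause ∈ c n} ⋁_{i ∈ clause} X(i)`, with an empty conjunction true and an
empty disjunction false. -/
def posEval (c : ℕ → List (List ℕ)) (X : Cantor) : Cantor :=
  fun n => (c n).all fun clause => clause.any fun i => X i

/-- The binary digit map. -/
noncomputable def digitMap : ℝ → Cantor :=
  fun (x : ℝ) (n : ℕ) => decide ((⌊x * 2 ^ (n + 1)⌋ % 2 : ℤ) = 1)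

lemma measurable_digitMap : Measurable digitMap := by
  refine measurable_pi_lambda _ fun n => ?_
  have h1 : Measurable (fun x : ℝ => ⌊x * 2 ^ (n + 1)⌋) :=
    Int.measurable_floor.comp (measurable_id.mul_const _)
  exact (measurable_of_countable (fun z : ℤ => decide (z % 2 = 1))).comp h1

lemma fairCoin_eq : fairCoin = Measure.map digitMap (volume.restrict (Set.Ico (0 : ℝ) 1)) := rfl

lemma fairCoin_univ : fairCoin Set.univ = 1 := by
  rw [fairCoin_eq, Measure.map_apply measurable_digitMap MeasurableSet.univ]
  simp

lemma floor_eq_of_digits (x y : ℝ) (hx : x ∈ Set.Ico (0 : ℝ) 1) (hy : y ∈ Set.Ico (0 : ℝ) 1) :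
    ∀ m : ℕ, (∀ i < m, digitMap x i = digitMap y i) → ⌊x * 2 ^ m⌋ = ⌊y * 2 ^ m⌋ := by
  have half : ∀ (z : ℝ) (m : ℕ), ⌊z * 2 ^ m⌋ = ⌊z * 2 ^ (m + 1)⌋ / 2 := by
    intro z m
    have h := Int.floor_div_natCast (z * 2 ^ (m + 1)) 2
    have e : z * 2 ^ (m + 1) / ((2 : ℕ) : ℝ) = z * 2 ^ m := by
      rw [pow_succ]; push_cast; ring
    rw [e] at h
    exact_mod_cast h
  intro m
  induction m with
  | zero =>
    intro _
    have h1 : ⌊x⌋ = 0 := Int.floor_eq_zero_iff.2 hx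
    have h2 : ⌊y⌋ = 0 := Int.floor_eq_zero_iff.2 hy
    simp [h1, h2]
  | succ m ih =>
    intro h
    have h1 := ih fun i hi => h i (by omega)
    have h2 := h m (by omega)
    rw [half x, half y] at h1
    simp only [digitMap, decide_eq_decide] at h2
    omega

lemma volume_cyl (m : ℕ) (s : Fin m → Bool) :
    volume {x : ℝ | x ∈ Set.Ico (0 : ℝ) 1 ∧ ∀ i : Fin m, digitMap x i = s i}
      ≤ ((2 : ENNReal) ^ m)⁻¹ := by
  rcases Set.eq_empty_or_nonempty
    {x : ℝ | x ∈ Set.Ico (0 : ℝ) 1 ∧ ∀ i : Fin m, digitMap x i = s i} with he | ⟨y, hy, hys⟩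
  · rw [he]; simp
  · have hsub : {x : ℝ | x ∈ Set.Ico (0 : ℝ) 1 ∧ ∀ i : Fin m, digitMap x i = s i} ⊆
        Set.Ico ((⌊y * 2 ^ m⌋ : ℝ) / 2 ^ m) (((⌊y * 2 ^ m⌋ : ℝ) + 1) / 2 ^ m) := by
      rintro x ⟨hx, hxs⟩
      have hfl := floor_eq_of_digits x y hx hy m
        (fun i hi => (hxs ⟨i, hi⟩).trans (hys ⟨i, hi⟩).symm)
      have hp : (0 : ℝ) < 2 ^ m := by positivity
      rw [← hfl]
      exact ⟨(div_le_iff₀ hp).2 (Int.floor_le _), (lt_div_iff₀ hp).2 (Int.lt_floor_add_one _)⟩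
    refine (measure_mono hsub).trans ?_
    rw [Real.volume_Ico, ← sub_div, add_sub_cancel_left, one_div,
      ENNReal.ofReal_inv_of_pos (by positivity), ENNReal.ofReal_pow (by norm_num)]
    simp

/-- Number of `i < m` with `h i = true`. -/
def cnt (h : ℕ → Bool) (m : ℕ) : ℕ :=
  Nat.rec (motive := fun _ => ℕ) 0 (fun i c => c + cond (h i) 1 0) m

/-- Check that `σ` has value `b` at all `i < m` with `h i = true`. -/
def okk (h : ℕ → Bool) (b : Bool) (σ : List Bool) (m : ℕ) : Bool :=
  Nat.rec (motive := fun _ => Bool) true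
    (fun i o => o && cond (h i) (decide (σ[i]? = some b)) true) m

lemma okk_iff (h : ℕ → Bool) (b : Bool) (σ : List Bool) (m : ℕ) :
    okk h b σ m = true ↔ ∀ i < m, h i = true → σ[i]? = some b := by
  induction m with
  | zero => simp [okk]
  | succ m ih =>
    have : okk h b σ (m + 1) = (okk h b σ m && cond (h m) (decide (σ[m]? = some b)) true) := rfl
    rw [this, Bool.and_eq_true, ih, Nat.forall_lt_succ_right]
    cases h m <;> simp

lemma cnt_succ (h : ℕ → Bool) (m : ℕ) : cnt h (m + 1) = cnt h m + cond (h m) 1 0 := rfl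

lemma card_constrained (h : ℕ → Bool) (m : ℕ) :
    (∏ i : Fin m, (if h i = true then 1 else 2)) * 2 ^ cnt h m = 2 ^ m := by
  induction m with
  | zero => simp [cnt]
  | succ m ih =>
    rw [Fin.prod_univ_castSucc, cnt_succ]
    simp only [Fin.val_castSucc, Fin.val_last]
    rw [pow_add, pow_succ 2 m, ← ih]
    by_cases hm : h m = true
    · simp only [hm, if_true, cond_true]; ring
    · have hm' : h m = false := by simpa using hm
      rw [if_neg hm, hm']
      simp only [cond_false]; ring

/-- Sequences constrained on the first `m` places. -/
def conSet (h : ℕ → Bool) (b : Bool) (m : ℕ) : Set Cantor :=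
  {X | ∀ i < m, h i = true → X i = b}

lemma fairCoin_conSet (h : ℕ → Bool) (b : Bool) (m : ℕ) :
    fairCoin (conSet h b m) ≤ ((2 : ENNReal) ^ cnt h m)⁻¹ := by
  have hmeas : MeasurableSet (conSet h b m) := by
    have : conSet h b m = ⋂ i : ℕ, ⋂ (_ : i < m), ⋂ (_ : h i = true), {X : Cantor | X i = b} := by
      ext X; simp [conSet]
    rw [this]
    refine MeasurableSet.iInter fun i => MeasurableSet.iInter fun _ => MeasurableSet.iInter fun _ => ?_
    have hi : Measurable fun X : Cantor => X i := measurable_pi_apply i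
    exact hi (MeasurableSet.singleton b)
  rw [fairCoin_eq, Measure.map_apply measurable_digitMap hmeas,
    Measure.restrict_apply (measurable_digitMap hmeas)]
  let F : Finset (Fin m → Bool) :=
    Fintype.piFinset fun i : Fin m => if h i = true then {b} else Finset.univ
  have hsub : digitMap ⁻¹' conSet h b m ∩ Set.Ico (0 : ℝ) 1 ⊆
      ⋃ s ∈ F, {x : ℝ | x ∈ Set.Ico (0 : ℝ) 1 ∧ ∀ i : Fin m, digitMap x i = s i} := by
    rintro x ⟨hx, hx1⟩
    simp only [Set.mem_iUnion]
    refine ⟨fun i => digitMap x i, ?_, hx1, fun i => rfl⟩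
    rw [Fintype.mem_piFinset]
    intro i
    by_cases hi : h i = true
    · simp only [hi, if_true, Finset.mem_singleton]
      exact hx i i.2 hi
    · simp [hi]
  refine (measure_mono hsub).trans ((measure_biUnion_finset_le _ _).trans ?_)
  refine (Finset.sum_le_sum fun s _ => volume_cyl m s).trans ?_
  rw [Finset.sum_const, nsmul_eq_mul]
  have hF : F.card * 2 ^ cnt h m = 2 ^ m := by
    rw [← card_constrained h m, Fintype.card_piFinset]
    congr 1
    refine Finset.prod_congr rfl fun i _ => ?_
    split_ifs <;> simp
  have hF' : (F.card : ENNReal) * 2 ^ cnt h m = 2 ^ m := by exact_mod_cast hF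
  rw [← hF', ENNReal.mul_inv (Or.inr (by simp)) (Or.inr (by simp)), ← mul_assoc]
  calc _ ≤ 1 * ((2 : ENNReal) ^ cnt h m)⁻¹ := by gcongr; exact ENNReal.mul_inv_le_one _
    _ = _ := one_mul _

/-- The test. -/
def conTest (h : ℕ → Bool) (b : Bool) (n k : ℕ) : Option (List Bool) :=
  (Encodable.decode (α := List Bool) k).bind fun σ =>
    cond (decide (n ≤ cnt h σ.length) && okk h b σ σ.length) (some σ) none

lemma computable_conTest (h : ℕ → Bool) (hh : Computable h) (b : Bool) :
    Computable₂ (conTest h b) := by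
  have hcnt : Computable (cnt h) := by
    refine Computable.nat_rec (f := fun m : ℕ => m) (g := fun _ => 0)
      (h := fun _ p => p.2 + cond (h p.1) 1 0) Computable.id (Computable.const 0) ?_
    have h1 : Computable fun p : ℕ × ℕ × ℕ => p.2.1 :=
      Computable.fst.comp Computable.snd
    have h2 : Computable fun p : ℕ × ℕ × ℕ => p.2.2 :=
      Computable.snd.comp Computable.snd
    exact Primrec.nat_add.to_comp.comp h2
      (Computable.cond (hh.comp h1) (Computable.const 1) (Computable.const 0))
  have hok : Computable fun σ : List Bool => okk h b σ σ.length := by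
    refine Computable.nat_rec (f := fun σ : List Bool => σ.length) (g := fun _ => true)
      (h := fun σ p => p.2 && cond (h p.1) (decide (σ[p.1]? = some b)) true)
      Computable.list_length (Computable.const true) ?_
    have h1 : Computable fun p : List Bool × ℕ × Bool => p.2.1 :=
      Computable.fst.comp Computable.snd
    have h2 : Computable fun p : List Bool × ℕ × Bool => p.2.2 :=
      Computable.snd.comp Computable.snd
    have h3 : Computable fun p : List Bool × ℕ × Bool => p.1[p.2.1]? :=
      Computable.list_getElem?.comp Computable.fst h1
    have h4 : Computable fun o : Option Bool => decide (o = some b) :=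
      (Primrec.eq.comp Primrec.id (Primrec.const (some b))).decide.to_comp
    exact Primrec.and.to_comp.comp h2
      (Computable.cond (hh.comp h1) (h4.comp h3) (Computable.const true))
  refine Computable.option_bind (f := fun p : ℕ × ℕ => Encodable.decode (α := List Bool) p.2)
    (g := fun p σ => cond (decide (p.1 ≤ cnt h σ.length) && okk h b σ σ.length) (some σ) none)
    (Computable.decode.comp Computable.snd) ?_
  have hle : Computable₂ fun a b : ℕ => decide (a ≤ b) := Primrec.nat_le.decide.to_comp
  refine Computable.cond (Primrec.and.to_comp.comp (hle.comp
    (Computable.fst.comp Computable.fst)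
    (hcnt.comp (Computable.list_length.comp Computable.snd))) (hok.comp Computable.snd))
    (Computable.option_some.comp Computable.snd) (Computable.const none)

lemma conTest_eq (h : ℕ → Bool) (b : Bool) (n k : ℕ) (σ : List Bool) :
    conTest h b n k = some σ ↔ Encodable.decode (α := List Bool) k = some σ ∧
      n ≤ cnt h σ.length ∧ ∀ i < σ.length, h i = true → σ[i]? = some b := by
  rw [← okk_iff]
  unfold conTest
  rw [Option.bind_eq_some_iff]
  constructor
  · rintro ⟨τ, h1, h2⟩
    rcases hc : (decide (n ≤ cnt h τ.length) && okk h b τ τ.length) with _ | _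
    · simp [hc] at h2
    · simp only [hc, cond_true, Option.some.injEq] at h2
      subst h2
      simpa [h1] using hc
  · rintro ⟨h1, h2, h3⟩
    exact ⟨σ, h1, by simp [h2, h3]⟩

lemma cnt_mono (h : ℕ → Bool) : Monotone (cnt h) :=
  monotone_nat_of_le_succ fun m => by rw [cnt_succ]; omega

lemma cnt_unbounded (h : ℕ → Bool) (hinf : ∀ n, ∃ m ≥ n, h m = true) (n : ℕ) :
    ∃ m, n ≤ cnt h m := by
  induction n with
  | zero => exact ⟨0, by omega⟩
  | succ n ih =>
    obtain ⟨m, hm⟩ := ih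
    obtain ⟨k, hk, hk'⟩ := hinf m
    refine ⟨k + 1, ?_⟩
    have := cnt_mono h hk
    rw [cnt_succ, hk']
    simp only [cond_true]
    omega

lemma not_mlr (h : ℕ → Bool) (hh : Computable h) (hinf : ∀ n, ∃ m ≥ n, h m = true) (b : Bool)
    (X : Cantor) (hX : ∀ i, h i = true → X i = b) : X ∉ MLR := by
  intro hmlr
  have hub := cnt_unbounded h hinf
  have htest : MLTest (conTest h b) := by
    refine ⟨computable_conTest h hh b, fun n => ?_⟩
    have hsub : testSet (conTest h b) n ⊆ conSet h b (Nat.find (hub n)) := by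
      intro Y hY
      simp only [testSet, Set.mem_iUnion, Set.mem_ofPred_eq] at hY
      obtain ⟨σ, ⟨k, hk⟩, hY⟩ := hY
      obtain ⟨-, h1, h2⟩ := (conTest_eq h b n k σ).1 hk
      intro i hi hhi
      have hle : Nat.find (hub n) ≤ σ.length := Nat.find_min' _ h1
      have hlt : i < σ.length := by omega
      have h3 := h2 i hlt hhi
      have h4 := hY i hlt
      rw [List.getElem?_eq_getElem hlt, Option.some.injEq] at h3
      rw [h4, ← h3]; rfl
    refine (measure_mono hsub).trans ((fairCoin_conSet h b _).trans ?_)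
    have := Nat.find_spec (hub n)
    exact ENNReal.inv_le_inv.2 (pow_le_pow_right₀ (by norm_num) this)
  obtain ⟨n, hn⟩ := hmlr _ htest
  apply hn
  obtain ⟨m, hm⟩ := hub n
  simp only [testSet, Set.mem_iUnion, Set.mem_ofPred_eq]
  refine ⟨List.ofFn fun i : Fin m => X i, ⟨Encodable.encode (List.ofFn fun i : Fin m => X i), ?_⟩, ?_⟩
  · rw [conTest_eq]
    refine ⟨Encodable.encodek _, by simpa using hm, ?_⟩
    intro i hi hhi
    rw [List.getElem?_eq_getElem hi]
    simp [hX i hhi]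
  · intro i hi
    simp

lemma mlr_nonempty : MLR.Nonempty := by
  by_contra hne
  rw [Set.not_nonempty_iff_eq_empty] at hne
  let T := {U : ℕ → ℕ → Option (List Bool) // MLTest U}
  have hc : Countable T := by
    let e : T → {f : ℕ → ℕ // Computable f} := fun U =>
      ⟨fun n => Encodable.encode (U.1 n.unpair.1 n.unpair.2),
        Computable.encode.comp (U.2.1.comp (Computable.fst.comp Computable.unpair)
          (Computable.snd.comp Computable.unpair))⟩
    refine Function.Injective.countable (f := e) ?_
    intro U V hUV
    apply Subtype.ext
    funext n k
    have := congrFun (congrArg Subtype.val hUV) (Nat.pair n k)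
    simpa [e] using this
  have hcover : (Set.univ : Set Cantor) ⊆ ⋃ U : T, ⋂ n, testSet U.1 n := by
    intro X _
    by_contra hX
    have : X ∈ MLR := by
      intro U hU
      by_contra hcon
      push Not at hcon
      exact hX (Set.mem_iUnion.2 ⟨⟨U, hU⟩, Set.mem_iInter.2 hcon⟩)
    rw [hne] at this
    exact this
  have hnull : fairCoin (⋃ U : T, ⋂ n, testSet U.1 n) = 0 := by
    rw [measure_iUnion_null_iff]
    rintro ⟨U, hU⟩
    have hle : ∀ n : ℕ, fairCoin (⋂ n, testSet U n) ≤ (2⁻¹ : ENNReal) ^ n := fun n => by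
      rw [← ENNReal.inv_pow]
      exact (measure_mono (Set.iInter_subset _ n)).trans (hU.2 n)
    have ht := ENNReal.tendsto_pow_atTop_nhds_zero_of_lt_one (r := 2⁻¹)
      (ENNReal.inv_lt_one.2 (by norm_num))
    exact le_antisymm (ge_of_tendsto' ht hle) zero_le
  have := measure_mono (μ := fairCoin) hcover
  rw [hnull, fairCoin_univ] at this
  simp at this

lemma posEval_mono (c : ℕ → List (List ℕ)) (X Y : Cantor) (hXY : ∀ i, X i = true → Y i = true)
    (n : ℕ) (hX : posEval c X n = true) : posEval c Y n = true := by
  simp only [posEval, List.all_eq_true, List.any_eq_true] at hX ⊢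
  intro C hC
  obtain ⟨i, hi, hXi⟩ := hX C hC
  exact ⟨i, hi, hXY i hXi⟩

lemma computable_posEval_even (c : ℕ → List (List ℕ)) (hc : Computable c) :
    Computable (posEval c fun i => decide (i % 2 = 0)) := by
  have h0 : PrimrecPred fun i : ℕ => i % 2 = 0 :=
    Primrec.eq.comp (Primrec.nat_mod.comp Primrec.id (Primrec.const 2)) (Primrec.const 0)
  have h1 := h0.exists_mem_list.forall_mem_list
  refine (h1.decide.to_comp.comp hc).of_eq fun n => ?_
  rw [Bool.eq_iff_iff]
  simp [posEval]

/-- MLR is not positively Medvedev reducible to Either(MLR). -/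
theorem mlr_not_le_sp_either_mlr :
    ¬ ∃ c : ℕ → List (List ℕ), Computable c ∧
      ∀ X ∈ Either MLR, posEval c X ∈ MLR := by
  rintro ⟨c, hc, hred⟩
  obtain ⟨A, hA⟩ := mlr_nonempty
  have hg := computable_posEval_even c hc
  set g := posEval c fun i => decide (i % 2 = 0) with hgdef
  by_cases hinf : ∀ n, ∃ m ≥ n, g m = true
  · refine not_mlr g hg hinf true (posEval c (join (fun _ => true) A)) ?_
      (hred _ ⟨_, A, rfl, Or.inr hA⟩)
    intro i hi
    refine posEval_mono c _ _ (fun j hj => ?_) i hi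
    have hj' : j % 2 = 0 := by simpa using hj
    simp [join, hj']
  · push Not at hinf
    obtain ⟨N, hN⟩ := hinf
    have hng : Computable fun n => !(g n) := Primrec.not.to_comp.comp hg
    refine not_mlr (fun n => !(g n)) hng
      (fun n => ⟨max n N, le_max_left _ _, by simpa using hN _ (le_max_right _ _)⟩) false
      (posEval c (join A (fun _ => false))) ?_ (hred _ ⟨A, _, rfl, Or.inl hA⟩)
    intro i hi
    by_contra hcon
    have hcon' : posEval c (join A (fun _ => false)) i = true := by simpa using hcon
    have : g i = true := by
      refine posEval_mono c _ _ (fun j hj => ?_) i hcon'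
      by_cases hj' : j % 2 = 0
      · simp [hj']
      · simp [join, hj'] at hj
    simp [this] at hi
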